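/- Let α ∈ (0,2) and define R : (0,1) → ℝ by R(a) = C_α ( T_α a^{-α/2} + α^{-1} a^{α/2} F_α(a) ). Then there exists a constant μ > 0 such that: (1) for every λ > μ, the set {a ∈ (0,1) : R(a) = λ} has exactly two elements; (2) for λ = μ, the set {a ∈ (0,1) : R(a) = μ} has exactly one element; (3) for every 0 < λ < μ, the set {a ∈ (0,1) : R(a) = λ} is empty. -/

import Mathlib

open MeasureTheory Real Filter Set

/-- Euler Beta function `B(x,y) = ∫₀¹ t^(x-1) (1-t)^(y-1) dt`. -/
noncomputable def betaFn (x y : ℝ) : ℝ :=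
  ∫ t in (0:ℝ)..1, t ^ (x - 1) * (1 - t) ^ (y - 1)

/-- `C_α = π⁻¹ sin(π α / 2)`. -/
noncomputable def Cc (α : ℝ) : ℝ := Real.sin (Real.pi * α / 2) / Real.pi

/-- `T_α = B(α, 1 - α/2)`. -/
noncomputable def Tc (α : ℝ) : ℝ := betaFn α (1 - α / 2)

/-- Gauss hypergeometric series `₂F₁(p, q; r; z)`. -/
noncomputable def hyp (p q r z : ℝ) : ℝ :=
  ∑' n : ℕ, ((ascPochhammer ℝ n).eval p * (ascPochhammer ℝ n).eval q) /
    ((ascPochhammer ℝ n).eval r * (n.factorial : ℝ)) * z ^ n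

/-- `R(a) = C_α (T_α a^(-α/2) + α⁻¹ a^(α/2) F_α(a))` where `F_α(a) = ₂F₁(α/2+1, α; α+1; a)`. -/
noncomputable def Rf (α a : ℝ) : ℝ :=
  Cc α * (Tc α * a ^ (-(α / 2)) + α⁻¹ * a ^ (α / 2) * hyp (α / 2 + 1) α (α + 1) a)

open Topology

/-- The Beta integral is positive for positive parameters. -/
theorem betaFn_pos {x y : ℝ} (hx : 0 < x) (hy : 0 < y) : 0 < betaFn x y := by
  refine intervalIntegral.intervalIntegral_pos_of_pos_on ?_ (fun t ht ↦ ?_) one_pos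
  · refine (Complex.betaIntegral_convergent (u := x) (v := y) (by simpa) (by simpa)).norm.congr ?_
    intro t ht
    rw [uIoc_of_le zero_le_one] at ht
    have h₀ : 0 ≤ t := ht.1.le
    have h₁ : 0 ≤ 1 - t := sub_nonneg.2 ht.2
    have e : (t : ℂ) ^ ((x : ℂ) - 1) * (1 - (t : ℂ)) ^ ((y : ℂ) - 1) =
        ((t ^ (x - 1) * (1 - t) ^ (y - 1) : ℝ) : ℂ) := by
      push_cast [Complex.ofReal_cpow h₀, Complex.ofReal_cpow h₁]
      rfl
    simp only [e, Complex.norm_real]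
    exact norm_of_nonneg (by positivity)
  · exact mul_pos (rpow_pos_of_pos ht.1 _) (rpow_pos_of_pos (sub_pos.2 ht.2) _)

/-- The coefficients of the series `F_α`. -/
noncomputable def hypCoeff (α : ℝ) (n : ℕ) : ℝ :=
  ((ascPochhammer ℝ n).eval (α / 2 + 1) * (ascPochhammer ℝ n).eval α) /
    ((ascPochhammer ℝ n).eval (α + 1) * (n.factorial : ℝ))

theorem ascPochhammer_eval_mul_add (x : ℝ) (n : ℕ) :
    (ascPochhammer ℝ n).eval x * (x + n) = x * (ascPochhammer ℝ n).eval (x + 1) := by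
  induction n with
  | zero => simp
  | succ n ih =>
    rw [ascPochhammer_succ_eval, ascPochhammer_succ_eval, ih]
    push_cast
    ring

theorem hypCoeff_eq {α : ℝ} (hα : 0 < α) (n : ℕ) :
    hypCoeff α n = (ascPochhammer ℝ n).eval (α / 2 + 1) / n.factorial * (α / (α + n)) := by
  have h := ascPochhammer_eval_mul_add α n
  have h₁ : 0 < (ascPochhammer ℝ n).eval (α + 1) := ascPochhammer_pos n _ (by positivity)
  have h₂ : 0 < α + n := by positivity
  have h₃ : (0 : ℝ) < n.factorial := by positivity
  rw [hypCoeff]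
  generalize (ascPochhammer ℝ n).eval (α / 2 + 1) = p
  field_simp
  linear_combination p * h

theorem factorial_le_ascPochhammer_eval {x : ℝ} (hx : 1 ≤ x) (n : ℕ) :
    (n.factorial : ℝ) ≤ (ascPochhammer ℝ n).eval x := by
  induction n with
  | zero => simp
  | succ n ih =>
    rw [ascPochhammer_succ_eval, Nat.factorial_succ, mul_comm]
    push_cast
    refine mul_le_mul ih ?_ (by positivity) (le_trans (by positivity) ih)
    linarith

theorem ascPochhammer_eval_le_factorial_succ {x : ℝ} (hx₀ : 0 < x) (hx : x ≤ 2) (n : ℕ) :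
    (ascPochhammer ℝ n).eval x ≤ (n + 1) * n.factorial := by
  induction n with
  | zero => simp
  | succ n ih =>
    have h : (ascPochhammer ℝ n).eval x * (x + n) ≤ (n + 1) * n.factorial * (2 + n) := by
      gcongr
    rw [ascPochhammer_succ_eval, Nat.factorial_succ]
    push_cast
    linarith

theorem hypCoeff_pos {α : ℝ} (hα : 0 < α) (n : ℕ) : 0 < hypCoeff α n := by
  have h := ascPochhammer_pos n (α / 2 + 1) (by positivity)
  rw [hypCoeff_eq hα]
  positivity

theorem hypCoeff_le {α : ℝ} (hα : 0 < α) (hα₂ : α ≤ 2) (n : ℕ) : hypCoeff α n ≤ n + 1 := by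
  have h := ascPochhammer_eval_le_factorial_succ (x := α / 2 + 1) (by positivity) (by linarith) n
  rw [hypCoeff_eq hα]
  have h₁ : (ascPochhammer ℝ n).eval (α / 2 + 1) / n.factorial ≤ n + 1 :=
    (div_le_iff₀ (by positivity)).2 h
  have h₂ : α / (α + n) ≤ 1 := (div_le_one (by positivity)).2 (by simp)
  calc _ ≤ ((n : ℝ) + 1) * 1 := by gcongr
    _ = n + 1 := mul_one _

theorem not_summable_hypCoeff {α : ℝ} (hα : 0 < α) : ¬ Summable (hypCoeff α) := by
  intro h
  have key : Summable fun n : ℕ ↦ α / (α + 1) * (1 / ((n + 1 : ℕ) : ℝ)) := by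
    refine h.of_nonneg_of_le (fun n ↦ by positivity) fun n ↦ ?_
    have h₁ : 1 ≤ (ascPochhammer ℝ n).eval (α / 2 + 1) / n.factorial :=
      (one_le_div (by positivity)).2 (factorial_le_ascPochhammer_eval (by linarith) n)
    calc α / (α + 1) * (1 / ((n + 1 : ℕ) : ℝ)) = α / ((α + 1) * (n + 1)) := by
          push_cast; field_simp
      _ ≤ α / (α + n) := by
          gcongr
          nlinarith [mul_nonneg hα.le (Nat.cast_nonneg (α := ℝ) n)]
      _ = 1 * (α / (α + n)) := (one_mul _).symm
      _ ≤ hypCoeff α n := by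
          rw [hypCoeff_eq hα]
          gcongr
  rw [summable_mul_left_iff (by positivity)] at key
  exact Real.not_summable_one_div_natCast
    ((summable_nat_add_iff (f := fun n : ℕ ↦ 1 / (n : ℝ)) 1).1 key)

theorem summable_hypCoeff_mul_exp {α s x : ℝ} (hα : 0 < α) (hα₂ : α ≤ 2) (hx : x < 0) :
    Summable fun n : ℕ ↦ hypCoeff α n * exp ((n + s) * x) := by
  have hr : ‖exp x‖ < 1 := by rwa [norm_of_nonneg (exp_nonneg _), exp_lt_one_iff]
  have h₁ := (summable_pow_mul_geometric_of_norm_lt_one 1 hr).add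
    (summable_pow_mul_geometric_of_norm_lt_one 0 hr)
  refine (h₁.mul_right (exp (s * x))).of_nonneg_of_le
    (fun n ↦ mul_nonneg (hypCoeff_pos hα n).le (exp_nonneg _)) fun n ↦ ?_
  rw [add_mul, exp_add, exp_nat_mul, ← mul_assoc]
  gcongr
  nlinarith [hypCoeff_le hα hα₂ n, pow_pos (exp_pos x) n]

/-- A pointwise sum of convex functions is convex. -/
theorem convexOn_tsum {s : Set ℝ} (hs : Convex ℝ s) {f : ℕ → ℝ → ℝ}
    (hf : ∀ n, ConvexOn ℝ s (f n)) (hsum : ∀ x ∈ s, Summable fun n ↦ f n x) :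
    ConvexOn ℝ s fun x ↦ ∑' n, f n x := by
  refine ⟨hs, fun x hx y hy a b ha hb hab ↦ ?_⟩
  have hx' := (hsum x hx).mul_left a
  have hy' := (hsum y hy).mul_left b
  simp only [smul_eq_mul]
  rw [← tsum_mul_left, ← tsum_mul_left, ← hx'.tsum_add hy']
  exact (hsum _ (hs hx hy ha hb hab)).tsum_le_tsum
    (fun n ↦ (hf n).2 hx hy ha hb hab) (hx'.add hy')

theorem strictConvexOn_exp_mul {c : ℝ} (hc : c ≠ 0) :
    StrictConvexOn ℝ univ fun x ↦ exp (c * x) := by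
  refine ⟨convex_univ, fun x _ y _ hxy a b ha hb hab ↦ ?_⟩
  have h := strictConvexOn_exp.2 (mem_univ (c * x)) (mem_univ (c * y))
    (by simpa [hc] using hxy) ha hb hab
  simp only [smul_eq_mul] at h ⊢
  convert h using 2
  ring

/-- In logarithmic coordinates, `R` is a positive combination of exponentials. -/
theorem Rf_exp (α x : ℝ) :
    Rf α (exp x) = Cc α * (Tc α * exp (-(α / 2) * x) +
      α⁻¹ * ∑' n : ℕ, hypCoeff α n * exp ((n + α / 2) * x)) := by
  have h : exp (α / 2 * x) * hyp (α / 2 + 1) α (α + 1) (exp x) =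
      ∑' n : ℕ, hypCoeff α n * exp ((n + α / 2) * x) := by
    rw [hyp, ← tsum_mul_left]
    refine tsum_congr fun n ↦ ?_
    rw [add_mul, exp_add, exp_nat_mul, hypCoeff]
    ring
  rw [Rf, ← exp_mul, ← exp_mul, ← h, mul_comm x, mul_comm x, mul_assoc α⁻¹]

theorem Cc_pos {α : ℝ} (hα : α ∈ Ioo (0 : ℝ) 2) : 0 < Cc α := by
  have := pi_pos
  refine div_pos (sin_pos_of_pos_of_lt_pi ?_ ?_) pi_pos
  · have := hα.1
    positivity
  · nlinarith [hα.2]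

theorem Tc_pos {α : ℝ} (hα : α ∈ Ioo (0 : ℝ) 2) : 0 < Tc α :=
  betaFn_pos hα.1 (by linarith [hα.2])

theorem tsum_hypCoeff_nonneg {α : ℝ} (hα : 0 < α) (x : ℝ) :
    0 ≤ ∑' n : ℕ, hypCoeff α n * exp ((n + α / 2) * x) :=
  tsum_nonneg fun n ↦ mul_nonneg (hypCoeff_pos hα n).le (exp_nonneg _)

theorem Rf_exp_pos {α : ℝ} (hα : α ∈ Ioo (0 : ℝ) 2) (x : ℝ) : 0 < Rf α (exp x) := by
  have h₁ := tsum_hypCoeff_nonneg hα.1 x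
  have h₂ := Cc_pos hα
  have h₃ := Tc_pos hα
  have h₄ := hα.1
  rw [Rf_exp]
  positivity

theorem strictConvexOn_Rf_exp {α : ℝ} (hα : α ∈ Ioo (0 : ℝ) 2) :
    StrictConvexOn ℝ (Iio 0) fun x ↦ Rf α (exp x) := by
  have hα₀ := hα.1
  have h₁ : StrictConvexOn ℝ (Iio (0 : ℝ)) fun x ↦ exp (-(α / 2) * x) :=
    (strictConvexOn_exp_mul (by linarith)).subset (subset_univ _) (convex_Iio 0)
  have h₂ : ConvexOn ℝ (Iio (0 : ℝ))
      fun x ↦ ∑' n : ℕ, hypCoeff α n * exp ((n + α / 2) * x) := by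
    refine convexOn_tsum (convex_Iio 0) (fun n ↦ ?_)
      fun x hx ↦ summable_hypCoeff_mul_exp hα.1 hα.2.le hx
    exact ((strictConvexOn_exp_mul (by positivity)).convexOn.subset
      (subset_univ _) (convex_Iio 0)).smul (hypCoeff_pos hα.1 n).le
  refine ⟨convex_Iio 0, fun x hx y hy hxy a b ha hb hab ↦ ?_⟩
  have e₁ := h₁.2 hx hy hxy ha hb hab
  have e₂ := h₂.2 hx hy ha.le hb.le hab
  simp only [Rf_exp, smul_eq_mul] at e₁ e₂ ⊢
  have e₃ := mul_lt_mul_of_pos_left (add_lt_add_of_lt_of_le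
    (mul_lt_mul_of_pos_left e₁ (Tc_pos hα))
    (mul_le_mul_of_nonneg_left e₂ (inv_nonneg.2 hα₀.le))) (Cc_pos hα)
  refine e₃.trans_eq ?_
  ring

theorem tendsto_Rf_exp_atBot {α : ℝ} (hα : α ∈ Ioo (0 : ℝ) 2) :
    Tendsto (fun x ↦ Rf α (exp x)) atBot atTop := by
  have h : Tendsto (fun x : ℝ ↦ Cc α * (Tc α * exp (-(α / 2) * x))) atBot atTop :=
    ((tendsto_exp_atTop.comp (tendsto_id.const_mul_atBot_of_neg
      (by linarith [hα.1]))).const_mul_atTop (Tc_pos hα)).const_mul_atTop (Cc_pos hα)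
  refine tendsto_atTop_mono (fun x ↦ ?_) h
  rw [Rf_exp]
  refine mul_le_mul_of_nonneg_left (le_add_of_nonneg_right ?_) (Cc_pos hα).le
  exact mul_nonneg (inv_nonneg.2 hα.1.le) (tsum_hypCoeff_nonneg hα.1 x)

theorem tendsto_tsum_hypCoeff_mul_exp {α : ℝ} (hα : α ∈ Ioo (0 : ℝ) 2) :
    Tendsto (fun x ↦ ∑' n : ℕ, hypCoeff α n * exp ((n + α / 2) * x)) (𝓝[<] 0) atTop := by
  refine tendsto_atTop.2 fun M ↦ ?_
  obtain ⟨N, hN⟩ := (((not_summable_iff_tendsto_nat_atTop_of_nonneg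
    fun n ↦ (hypCoeff_pos hα.1 n).le).1 (not_summable_hypCoeff hα.1)).eventually_gt_atTop M).exists
  have hc : Continuous fun x : ℝ ↦
      ∑ n ∈ Finset.range N, hypCoeff α n * exp ((n + α / 2) * x) := by fun_prop
  have hev := (hc.tendsto 0).eventually_const_lt (u := M) (by simpa using hN)
  filter_upwards [nhdsWithin_le_nhds hev, self_mem_nhdsWithin] with x hx hx₀
  exact hx.le.trans ((summable_hypCoeff_mul_exp hα.1 hα.2.le hx₀).sum_le_tsum _
    fun n _ ↦ mul_nonneg (hypCoeff_pos hα.1 n).le (exp_nonneg _))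

theorem tendsto_Rf_exp_zero {α : ℝ} (hα : α ∈ Ioo (0 : ℝ) 2) :
    Tendsto (fun x ↦ Rf α (exp x)) (𝓝[<] 0) atTop := by
  refine tendsto_atTop_mono (fun x ↦ ?_) (((tendsto_tsum_hypCoeff_mul_exp hα).const_mul_atTop
    (inv_pos.2 hα.1)).const_mul_atTop (Cc_pos hα))
  rw [Rf_exp]
  refine mul_le_mul_of_nonneg_left (le_add_of_nonneg_left ?_) (Cc_pos hα).le
  exact mul_nonneg (Tc_pos hα).le (exp_nonneg _)

/-- A strictly convex function takes a value at most twice. -/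
theorem StrictConvexOn.not_three_eq {s : Set ℝ} {f : ℝ → ℝ} (hf : StrictConvexOn ℝ s f)
    {x y z l : ℝ} (hx : x ∈ s) (hz : z ∈ s) (hxy : x < y) (hyz : y < z)
    (fx : f x = l) (fy : f y = l) (fz : f z = l) : False := by
  have h := hf.lt_on_openSegment hx hz (hxy.trans hyz).ne
    (by rw [openSegment_eq_Ioo (hxy.trans hyz)]; exact ⟨hxy, hyz⟩ : y ∈ openSegment ℝ x z)
  simp [fx, fy, fz] at h

/-- Level sets of a strictly convex function on `(-∞, 0)` blowing up at both ends. -/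
theorem StrictConvexOn.level_sets {f : ℝ → ℝ} (hf : StrictConvexOn ℝ (Iio 0) f)
    (hbot : Tendsto f atBot atTop) (hzero : Tendsto f (𝓝[<] 0) atTop) :
    ∃ x₀ < 0, (∀ x < 0, f x₀ ≤ f x) ∧ (∀ x < 0, f x = f x₀ → x = x₀) ∧
      ∀ l, f x₀ < l → ∃ u v, u < v ∧ ∀ x, x < 0 ∧ f x = l ↔ x = u ∨ x = v := by
  have hcont : ContinuousOn f (Iio 0) := hf.convexOn.continuousOn isOpen_Iio
  have left (M a : ℝ) : ∃ u < a, M < f u :=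
    ((eventually_lt_atBot a).and (hbot.eventually_gt_atTop M)).exists
  have right (M : ℝ) {a : ℝ} (ha : a < 0) : ∃ v ∈ Ioo a 0, M < f v :=
    (Filter.Eventually.and (Ioo_mem_nhdsLT ha) (hzero.eventually_gt_atTop M)).exists
  have hmin : ∃ x₀ < 0, ∀ x < 0, f x₀ ≤ f x := by
    obtain ⟨u, hu⟩ := eventually_atBot.1 (hbot.eventually_gt_atTop (f (-1)))
    obtain ⟨v, hv, hv'⟩ := (mem_nhdsLT_iff_exists_Ioo_subset' (by norm_num : (-1 : ℝ) < 0)).1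
      (hzero.eventually_gt_atTop (f (-1)))
    have hsub : Icc u v ⊆ Iio 0 := fun x hx ↦ hx.2.trans_lt hv
    have hmem : (-1 : ℝ) ∈ Icc u v := by
      constructor <;> by_contra! h
      · exact lt_irrefl _ (hu _ h.le)
      · have : f (-1) < f (-1) := hv' ⟨h, by norm_num⟩
        exact lt_irrefl _ this
    obtain ⟨x₀, hx₀, hm⟩ := isCompact_Icc.exists_isMinOn ⟨_, hmem⟩ (hcont.mono hsub)
    refine ⟨x₀, hsub hx₀, fun x hx ↦ ?_⟩
    have h₁ : f x₀ ≤ f (-1) := hm hmem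
    rcases le_or_gt x u with h | h
    · exact h₁.trans (hu x h).le
    rcases le_or_gt x v with h' | h'
    · exact hm ⟨h.le, h'⟩
    · exact h₁.trans (hv' ⟨h', hx⟩ : f (-1) < f x).le
  obtain ⟨x₀, hx₀, hm⟩ := hmin
  refine ⟨x₀, hx₀, hm, fun x hx hxe ↦ ?_, fun l hl ↦ ?_⟩
  · exact hf.eq_of_isMinOn (fun y hy ↦ hxe.trans_le (hm y hy)) hm hx hx₀
  · obtain ⟨p, hp, hlp⟩ := left l x₀
    obtain ⟨q, hq, hlq⟩ := right l hx₀
    obtain ⟨u, hu, rfl⟩ := intermediate_value_Ioo' hp.le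
      (hcont.mono fun x hx ↦ hx.2.trans_lt hx₀) ⟨hl, hlp⟩
    obtain ⟨v, hv, hvu⟩ := intermediate_value_Ioo hq.1.le
      (hcont.mono fun x hx ↦ hx.2.trans_lt hq.2) ⟨hl, hlq⟩
    have hu₀ : u < 0 := hu.2.trans hx₀
    have hv₀ : v < 0 := hv.2.trans hq.2
    have huv : u < v := hu.2.trans hv.1
    refine ⟨u, v, huv, fun x ↦ ⟨fun ⟨hx, hxu⟩ ↦ ?_, ?_⟩⟩
    · by_contra! hne
      rcases lt_or_gt_of_ne hne.1 with h | h
      · exact hf.not_three_eq hx hv₀ h huv hxu rfl hvu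
      · rcases lt_or_gt_of_ne hne.2 with h' | h'
        · exact hf.not_three_eq hu₀ hv₀ h h' rfl hxu hvu
        · exact hf.not_three_eq hu₀ hx huv h' rfl hvu hxu
    · rintro (rfl | rfl)
      exacts [⟨hu₀, rfl⟩, ⟨hv₀, hvu⟩]

/-- Structure of the level sets of `R`: there is `μ > 0` such that `{R = λ}` has exactly two
elements for `λ > μ`, exactly one for `λ = μ`, and none for `0 < λ < μ`. -/
theorem Rf_level_set_structure (α : ℝ) (hα : α ∈ Set.Ioo (0:ℝ) 2) :
    ∃ μ : ℝ, 0 < μ ∧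
      (∀ l : ℝ, μ < l → {a : ℝ | a ∈ Set.Ioo (0:ℝ) 1 ∧ Rf α a = l}.encard = 2) ∧
      {a : ℝ | a ∈ Set.Ioo (0:ℝ) 1 ∧ Rf α a = μ}.encard = 1 ∧
      (∀ l : ℝ, 0 < l → l < μ → {a : ℝ | a ∈ Set.Ioo (0:ℝ) 1 ∧ Rf α a = l} = ∅) := by
  obtain ⟨x₀, hx₀, hmin, huniq, htwo⟩ := (strictConvexOn_Rf_exp hα).level_sets
    (tendsto_Rf_exp_atBot hα) (tendsto_Rf_exp_zero hα)
  have himage (l : ℝ) : {a : ℝ | a ∈ Ioo (0 : ℝ) 1 ∧ Rf α a = l} =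
      exp '' {x | x < 0 ∧ Rf α (exp x) = l} := by
    ext a
    constructor
    · rintro ⟨ha, hl⟩
      exact ⟨log a, ⟨log_neg ha.1 ha.2, by rwa [exp_log ha.1]⟩, exp_log ha.1⟩
    · rintro ⟨x, ⟨hx, hl⟩, rfl⟩
      exact ⟨⟨exp_pos x, exp_lt_one_iff.2 hx⟩, hl⟩
  refine ⟨Rf α (exp x₀), Rf_exp_pos hα x₀, fun l hl ↦ ?_, ?_, fun l _ hl ↦ ?_⟩
  · obtain ⟨u, v, huv, h⟩ := htwo l hl
    rw [himage, exp_injective.encard_image]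
    simp only [h]
    exact encard_pair huv.ne
  · rw [himage, exp_injective.encard_image, encard_eq_one]
    refine ⟨x₀, Subset.antisymm (fun x hx ↦ huniq x hx.1 hx.2) ?_⟩
    rintro x rfl
    exact ⟨hx₀, rfl⟩
  · rw [himage, image_eq_empty, eq_empty_iff_forall_notMem]
    rintro x ⟨hx, hxl⟩
    exact (hmin x hx).not_gt (hxl.trans_lt hl)
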